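/- arXiv:2601.12408 — 2 statements merged into one kernel-verified Lean document; each statement's English description precedes it below -/
import Mathlib

section
/- Let A be a 2n×2n real symmetric positive definite matrix with n×n blocks A = [[A_{11}, A_{12}],[A_{12}^T, A_{22}]], and let Δ_w(A) be the n-vector with i-th entry sqrt(((A_{11})_{ii}^2 + (A_{22})_{ii}^2 + 2(A_{12})_{ii}^2)/2). Then Δ_w(A) is weakly supermajorized by the symplectic spectrum d(A): for all 1 ≤ k ≤ n, the sum of the k smallest entries of Δ_w(A) is at least Σ_{j=1}^k d_j(A). -/
open Matrix BigOperators

/-- The standard symplectic form matrix `J = [[0, I], [-I, 0]]`. -/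
def Jm (ι : Type*) [Fintype ι] [DecidableEq ι] : Matrix (ι ⊕ ι) (ι ⊕ ι) ℝ :=
  Matrix.fromBlocks 0 1 (-1) 0

/-- A real `2n × 2n` matrix is symplectic if `Mᵀ J M = J`. -/
def IsSymplectic {ι : Type*} [Fintype ι] [DecidableEq ι]
    (M : Matrix (ι ⊕ ι) (ι ⊕ ι) ℝ) : Prop :=
  Mᵀ * Jm ι * M = Jm ι

/-- A subspace `W` of `ℝ^{2n}` is symplectic if every nonzero `u ∈ W` pairs
nontrivially via `J` with some `v ∈ W`. -/
def IsSymplecticSubspace {ι : Type*} [Fintype ι] [DecidableEq ι]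
    (W : Submodule ℝ ((ι ⊕ ι) → ℝ)) : Prop :=
  ∀ u ∈ W, u ≠ 0 → ∃ v ∈ W, u ⬝ᵥ (Jm ι).mulVec v ≠ 0

/-- `A` has symplectic kernel. -/
def HasSymplecticKernel {ι : Type*} [Fintype ι] [DecidableEq ι]
    (A : Matrix (ι ⊕ ι) (ι ⊕ ι) ℝ) : Prop :=
  IsSymplecticSubspace (LinearMap.ker A.mulVecLin)

/-- `d` is a vector of symplectic eigenvalues of `A` (Williamson diagonalization). -/
def IsSympSpectrum {ι : Type*} [Fintype ι] [DecidableEq ι]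
    (A : Matrix (ι ⊕ ι) (ι ⊕ ι) ℝ) (d : ι → ℝ) : Prop :=
  ∃ M : Matrix (ι ⊕ ι) (ι ⊕ ι) ℝ, IsSymplectic M ∧
    Mᵀ * A * M = Matrix.fromBlocks (Matrix.diagonal d) 0 0 (Matrix.diagonal d)

/-- Doubly stochastic matrix. -/
def DoublyStochastic {n : ℕ} (E : Matrix (Fin n) (Fin n) ℝ) : Prop :=
  (∀ i j, 0 ≤ E i j) ∧ (∀ i, ∑ j, E i j = 1) ∧ (∀ j, ∑ i, E i j = 1)

/-- Doubly superstochastic matrix: entrywise dominates a doubly stochastic matrix. -/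
def DoublySuperstochastic {n : ℕ} (S : Matrix (Fin n) (Fin n) ℝ) : Prop :=
  ∃ E, DoublyStochastic E ∧ ∀ i j, E i j ≤ S i j

/-- `X` lies in the convex hull of the symplectic orbit of `B`. -/
def InSympHull {ι : Type*} [Fintype ι] [DecidableEq ι]
    (B X : Matrix (ι ⊕ ι) (ι ⊕ ι) ℝ) : Prop :=
  ∃ (m : ℕ) (p : Fin m → ℝ) (M : Fin m → Matrix (ι ⊕ ι) (ι ⊕ ι) ℝ),
    (∀ i, 0 ≤ p i) ∧ (∑ i, p i = 1) ∧ (∀ i, IsSymplectic (M i)) ∧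
    X = ∑ i, p i • ((M i)ᵀ * B * M i)

/-- Sum of the `k` smallest entries of `x`. -/
noncomputable def psum {n : ℕ} (x : Fin n → ℝ) (k : ℕ) : ℝ :=
  ∑ j ∈ Finset.univ.filter (fun j : Fin n => (j : ℕ) < k), x (Tuple.sort x j)

/-- An orthonormal family of vectors vanishing outside `T` satisfies Bessel's inequality with
respect to the restriction to `T` of any vector. -/
lemma sum_sq_dotProduct_le_of_support {κ σ : Type*} [Fintype κ] [DecidableEq κ] [Fintype σ]
    {v : σ → EuclideanSpace ℝ κ} (hv : Orthonormal ℝ v) (T : Finset κ)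
    (hT : ∀ i, ∀ b ∉ T, v i b = 0) (r : κ → ℝ) :
    ∑ i, (∑ b, r b * v i b) ^ 2 ≤ ∑ b ∈ T, r b ^ 2 := by
  let x : EuclideanSpace ℝ κ := WithLp.toLp 2 fun b => if b ∈ T then r b else 0
  have h := hv.sum_inner_products_le x (s := Finset.univ)
  have hx : ‖x‖ ^ 2 = ∑ b ∈ T, r b ^ 2 := by
    simp [EuclideanSpace.norm_sq_eq, x, ite_pow, Finset.sum_ite_mem]
  rw [hx] at h
  refine le_trans (le_of_eq (Finset.sum_congr rfl fun i _ => ?_)) h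
  rw [Real.norm_eq_abs, sq_abs, PiLp.inner_apply]
  congr 1
  refine Finset.sum_congr rfl fun b _ => ?_
  by_cases hb : b ∈ T
  · simp [x, hb]
  · simp [hT i b hb]

lemma Jm_mul_self (ι : Type*) [Fintype ι] [DecidableEq ι] : Jm ι * Jm ι = -1 := by
  rw [Jm, fromBlocks_multiply, ← fromBlocks_one, fromBlocks_neg]
  simp

lemma dotProduct_Jm_mulVec {ι : Type*} [Fintype ι] [DecidableEq ι] (x y : ι ⊕ ι → ℝ) :
    x ⬝ᵥ Jm ι *ᵥ y = ∑ a, (x (Sum.inl a) * y (Sum.inr a) - x (Sum.inr a) * y (Sum.inl a)) := by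
  have hl (a : ι) : (Jm ι *ᵥ y) (Sum.inl a) = y (Sum.inr a) := by
    simp [Jm, fromBlocks_mulVec]
  have hr (a : ι) : (Jm ι *ᵥ y) (Sum.inr a) = -y (Sum.inl a) := by
    simp [Jm, fromBlocks_mulVec, neg_mulVec]
  simp [dotProduct, hl, hr, Finset.sum_add_distrib, sub_eq_add_neg]

/-- If `N` is symplectic and `x` has `N x` vanishing off the modes in `R`, then `|x|²` is at most
half the sum of the squared `R`-entries of `N x` and of `N J x`. -/
lemma IsSymplectic.dotProduct_self_le {ι : Type*} [Fintype ι] [DecidableEq ι]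
    {N : Matrix (ι ⊕ ι) (ι ⊕ ι) ℝ} (hN : IsSymplectic N) (R : Finset ι) (x : ι ⊕ ι → ℝ)
    (hx : ∀ a ∉ R.disjSum R, (N *ᵥ x) a = 0) :
    2 * (x ⬝ᵥ x) ≤
      ∑ a ∈ R.disjSum R, ((N *ᵥ x) a ^ 2 + (N *ᵥ (Jm ι *ᵥ x)) a ^ 2) := by
  have h : x ⬝ᵥ x = -((N *ᵥ x) ⬝ᵥ Jm ι *ᵥ (N *ᵥ (Jm ι *ᵥ x))) := by
    have : (N *ᵥ x) ⬝ᵥ Jm ι *ᵥ (N *ᵥ (Jm ι *ᵥ x)) = x ⬝ᵥ (Nᵀ * Jm ι * N * Jm ι) *ᵥ x := by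
      rw [dotProduct_comm, ← vecMul_transpose N x, dotProduct_comm, ← dotProduct_mulVec]
      simp only [mulVec_mulVec, Matrix.mul_assoc]
    rw [this, hN, Jm_mul_self, neg_mulVec, one_mulVec, dotProduct_neg, neg_neg]
  rw [h, dotProduct_Jm_mulVec]
  set u := N *ᵥ x
  set w := N *ᵥ (Jm ι *ᵥ x)
  rw [Finset.sum_disjSum, ← Finset.sum_add_distrib,
    ← Finset.sum_subset (Finset.subset_univ R), ← Finset.sum_neg_distrib, Finset.mul_sum]
  · refine Finset.sum_le_sum fun a _ => ?_
    nlinarith [sq_nonneg (u (Sum.inl a) + w (Sum.inr a)),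
      sq_nonneg (u (Sum.inr a) - w (Sum.inl a))]
  · intro a _ ha
    rw [hx (Sum.inl a) (by simpa using ha), hx (Sum.inr a) (by simpa using ha)]
    simp

lemma card_add_card_le_sum_sq {ι : Type*} [Fintype ι] [DecidableEq ι]
    {N : Matrix (ι ⊕ ι) (ι ⊕ ι) ℝ} (hN : IsSymplectic N) (R I : Finset ι) :
    2 * ((R.card : ℝ) + I.card - Fintype.card ι) ≤
      ∑ a ∈ R.disjSum R, ∑ b ∈ I.disjSum I, N a b ^ 2 := by
  let L : EuclideanSpace ℝ (ι ⊕ ι) →ₗ[ℝ]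
      (({b // b ∉ I.disjSum I} → ℝ) × ({a // a ∉ R.disjSum R} → ℝ)) :=
    { toFun := fun x => (fun b => x b, fun a => (N *ᵥ x.ofLp) a)
      map_add' := fun x y => by ext <;> simp [mulVec_add]
      map_smul' := fun c x => by ext <;> simp [mulVec_smul] }
  let V := LinearMap.ker L
  let e := stdOrthonormalBasis ℝ V
  let v : Fin (Module.finrank ℝ V) → EuclideanSpace ℝ (ι ⊕ ι) := fun i => (e i : _)
  have hv : Orthonormal ℝ v := e.orthonormal.comp_linearIsometry V.subtypeₗᵢ
  have hL (i) : L (v i) = 0 := (e i).2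
  have hI (i) : ∀ b ∉ I.disjSum I, v i b = 0 :=
    fun b hb => congrFun (congrArg Prod.fst (hL i)) ⟨b, hb⟩
  have hR (i) : ∀ a ∉ R.disjSum R, (N *ᵥ (v i).ofLp) a = 0 :=
    fun a ha => congrFun (congrArg Prod.snd (hL i)) ⟨a, ha⟩
  have hdim : 2 * (R.card + I.card) ≤ Module.finrank ℝ V + 2 * Fintype.card ι := by
    have h1 := L.finrank_range_add_finrank_ker
    have h2 := (LinearMap.range L).finrank_le
    have hi := Finset.card_le_univ (I.disjSum I)
    have hr := Finset.card_le_univ (R.disjSum R)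
    rw [Module.finrank_prod, Module.finrank_fintype_fun_eq_card,
      Module.finrank_fintype_fun_eq_card, Fintype.card_subtype_compl,
      Fintype.card_subtype_compl] at h2
    simp only [Fintype.card_coe, Finset.card_disjSum, Fintype.card_sum, finrank_euclideanSpace]
      at h1 h2 hi hr
    change Module.finrank ℝ (LinearMap.range L) + Module.finrank ℝ V = _ at h1
    omega
  have hone (i) : (v i).ofLp ⬝ᵥ (v i).ofLp = 1 := by
    have h := hv.1 i
    have h2 := EuclideanSpace.norm_sq_eq (v i)
    rw [h] at h2
    simp only [dotProduct, ← sq]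
    simpa using h2.symm
  have hsum : 2 * (Module.finrank ℝ V : ℝ) ≤
      ∑ a ∈ R.disjSum R, ∑ i, ((N *ᵥ (v i).ofLp) a ^ 2 + (N *ᵥ (Jm ι *ᵥ (v i).ofLp)) a ^ 2) := by
    rw [Finset.sum_comm]
    calc 2 * (Module.finrank ℝ V : ℝ) = ∑ i, 2 * ((v i).ofLp ⬝ᵥ (v i).ofLp) := by
          simp [hone, mul_comm]
      _ ≤ _ := Finset.sum_le_sum fun i _ => hN.dotProduct_self_le R _ (hR i)
  have hbessel (a : ι ⊕ ι) :
      ∑ i, ((N *ᵥ (v i).ofLp) a ^ 2 + (N *ᵥ (Jm ι *ᵥ (v i).ofLp)) a ^ 2) ≤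
        2 * ∑ b ∈ I.disjSum I, N a b ^ 2 := by
    have h1 := sum_sq_dotProduct_le_of_support hv _ hI (N a)
    have h2 := sum_sq_dotProduct_le_of_support hv _ hI ((N * Jm ι) a)
    have h3 : ∑ b ∈ I.disjSum I, (N * Jm ι) a b ^ 2 = ∑ b ∈ I.disjSum I, N a b ^ 2 := by
      rw [Finset.sum_disjSum, Finset.sum_disjSum, add_comm]
      simp [Matrix.mul_apply, Jm, Matrix.one_apply]
    rw [h3] at h2
    rw [Finset.sum_add_distrib, two_mul]
    simp only [mulVec_mulVec]
    exact add_le_add h1 h2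
  have hle := hsum.trans (Finset.sum_le_sum fun a _ => hbessel a)
  rw [← Finset.mul_sum] at hle
  have hdim' : 2 * ((R.card : ℝ) + I.card) ≤ Module.finrank ℝ V + 2 * Fintype.card ι := by
    exact_mod_cast hdim
  linarith

/-- Abel summation: nonnegative tail sums pair nonnegatively with a nonnegative monotone
sequence. -/
lemma sum_mul_nonneg_of_tail_nonneg {n : ℕ} {d z : Fin n → ℝ} (hm : Monotone d)
    (hd : ∀ i, 0 ≤ d i)
    (hz : ∀ m : ℕ, 0 ≤ ∑ j ∈ Finset.univ.filter (fun j : Fin n => m ≤ (j : ℕ)), z j) :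
    0 ≤ ∑ j, d j * z j := by
  induction n with
  | zero => simp
  | succ n ih =>
    have h := ih (d := fun j => d j.succ - d 0) (z := fun j => z j.succ)
      (fun i j hij => sub_le_sub_right (hm (Fin.succ_le_succ_iff.2 hij)) _)
      (fun i => sub_nonneg.2 (hm (Fin.zero_le _)))
      (fun m => by
        have := hz (m + 1)
        rw [Finset.sum_filter, Fin.sum_univ_succ] at this
        rw [Finset.sum_filter]
        simpa using this)
    have h0 := mul_nonneg (hd 0) (hz 0)
    simp only [zero_le, Finset.filter_true, Fin.sum_univ_succ] at h0
    rw [Fin.sum_univ_succ]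
    simp only [sub_mul, Finset.sum_sub_distrib, ← Finset.mul_sum] at h
    linarith

lemma sum_filter_lt_le_sum_mul {n : ℕ} {d w : Fin n → ℝ} (hm : Monotone d)
    (hd : ∀ i, 0 ≤ d i) (hw : ∀ i, 0 ≤ w i) (k : ℕ)
    (htail : ∀ R : Finset (Fin n), (R.card : ℝ) + k - n ≤ ∑ j ∈ R, w j) :
    ∑ j ∈ Finset.univ.filter (fun j : Fin n => (j : ℕ) < k), d j ≤ ∑ j, d j * w j := by
  have h := sum_mul_nonneg_of_tail_nonneg (z := fun j => w j - if (j : ℕ) < k then 1 else 0)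
    hm hd fun m => by
      rw [Finset.sum_sub_distrib, sub_nonneg, Finset.sum_boole, Finset.filter_filter]
      rcases le_total k m with hkm | hkm
      · rw [Finset.filter_false_of_mem (fun j _ hj => by omega)]
        simpa using Finset.sum_nonneg fun j _ => hw j
      · refine le_trans ?_ (htail _)
        have hlt : (Finset.univ.filter fun j : Fin n => (j : ℕ) < m).card = min n m := by
          simp [Fin.card_filter_val_lt]
        have hsplit := Finset.card_filter_add_card_filter_not (s := Finset.univ)
          (fun j : Fin n => m ≤ (j : ℕ))
        simp only [not_le, hlt, Finset.card_univ, Fintype.card_fin] at hsplit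
        have hIco : (Finset.univ.filter fun j : Fin n => m ≤ (j : ℕ) ∧ (j : ℕ) < k).card ≤ k - m := by
          rw [← Nat.card_Ico m k, ← Finset.card_map Fin.valEmbedding]
          refine Finset.card_le_card fun a ha => ?_
          simp only [Finset.mem_map, Finset.mem_filter, Fin.valEmbedding_apply] at ha
          obtain ⟨j, hj, rfl⟩ := ha
          exact Finset.mem_Ico.2 hj.2
        have hmin := min_le_right n m
        have : (Finset.univ.filter fun j : Fin n => m ≤ (j : ℕ) ∧ (j : ℕ) < k).card + n ≤
            (Finset.univ.filter fun j : Fin n => m ≤ (j : ℕ)).card + k := by omega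
        have : (((Finset.univ.filter fun j : Fin n => m ≤ (j : ℕ) ∧ (j : ℕ) < k).card : ℝ)) + n ≤
            (Finset.univ.filter fun j : Fin n => m ≤ (j : ℕ)).card + k := by exact_mod_cast this
        linarith
  simp only [mul_sub, Finset.sum_sub_distrib, mul_ite, mul_one, mul_zero,
    ← Finset.sum_filter] at h
  linarith

lemma IsSympSpectrum.nonneg {ι : Type*} [Fintype ι] [DecidableEq ι]
    {A : Matrix (ι ⊕ ι) (ι ⊕ ι) ℝ} {d : ι → ℝ} (hd : IsSympSpectrum A d) (hA : A.PosSemidef)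
    (i : ι) : 0 ≤ d i := by
  obtain ⟨M, -, hM⟩ := hd
  have h := (hA.conjTranspose_mul_mul_same M).diag_nonneg (i := Sum.inl i)
  rw [conjTranspose_eq_transpose_of_trivial, hM] at h
  simpa using h

lemma IsSympSpectrum.exists_isSymplectic_eq {ι : Type*} [Fintype ι] [DecidableEq ι]
    {A : Matrix (ι ⊕ ι) (ι ⊕ ι) ℝ} {d : ι → ℝ} (hd : IsSympSpectrum A d) :
    ∃ N, IsSymplectic N ∧ A = Nᵀ * fromBlocks (diagonal d) 0 0 (diagonal d) * N := by
  obtain ⟨M, hM, hMA⟩ := hd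
  have hinv : (-(Jm ι) * Mᵀ * Jm ι) * M = 1 := by
    rw [Matrix.mul_assoc, Matrix.mul_assoc, ← Matrix.mul_assoc Mᵀ, hM, neg_mul, Jm_mul_self,
      neg_neg]
  generalize -(Jm ι) * Mᵀ * Jm ι = N at hinv
  have hinv' : M * N = 1 := mul_eq_one_comm.1 hinv
  have hconj (B : Matrix (ι ⊕ ι) (ι ⊕ ι) ℝ) : Nᵀ * (Mᵀ * B * M) * N = B := by
    calc Nᵀ * (Mᵀ * B * M) * N = (M * N)ᵀ * B * (M * N) := by
          simp only [transpose_mul, Matrix.mul_assoc]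
      _ = B := by simp [hinv']
  refine ⟨N, ?_, by rw [← hMA, hconj]⟩
  have := hconj (Jm ι)
  rwa [hM] at this

lemma transpose_mul_fromBlocks_diagonal_mul_apply_self {ι : Type*} [Fintype ι] [DecidableEq ι]
    (N : Matrix (ι ⊕ ι) (ι ⊕ ι) ℝ) (d : ι → ℝ) (b : ι ⊕ ι) :
    (Nᵀ * fromBlocks (diagonal d) 0 0 (diagonal d) * N) b b =
      ∑ j, d j * (N (Sum.inl j) b ^ 2 + N (Sum.inr j) b ^ 2) := by
  rw [fromBlocks_diagonal, Matrix.mul_apply]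
  simp only [mul_diagonal, transpose_apply, Fintype.sum_sum_type, Sum.elim_inl, Sum.elim_inr,
    ← Finset.sum_add_distrib]
  exact Finset.sum_congr rfl fun j _ => by ring

lemma half_add_le_sqrt (a b c : ℝ) :
    (a + b) / 2 ≤ Real.sqrt ((a ^ 2 + b ^ 2 + 2 * c ^ 2) / 2) :=
  Real.le_sqrt_of_sq_le (by nlinarith [sq_nonneg (a - b), sq_nonneg c])

/-- A lower bound for partial traces over `k` modes in terms of the `k` smallest symplectic
eigenvalues. -/
lemma sum_symplectic_eigenvalues_le {n : ℕ} {A : Matrix (Fin n ⊕ Fin n) (Fin n ⊕ Fin n) ℝ}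
    (hA : A.PosSemidef) {d : Fin n → ℝ} (hd : IsSympSpectrum A d) (hm : Monotone d)
    (I : Finset (Fin n)) :
    ∑ j ∈ Finset.univ.filter (fun j : Fin n => (j : ℕ) < I.card), d j ≤
      ∑ i ∈ I, (A (Sum.inl i) (Sum.inl i) + A (Sum.inr i) (Sum.inr i)) / 2 := by
  obtain ⟨N, hN, hNA⟩ := hd.exists_isSymplectic_eq
  let w : Fin n → ℝ := fun j =>
    (∑ b ∈ I.disjSum I, (N (Sum.inl j) b ^ 2 + N (Sum.inr j) b ^ 2)) / 2
  have htrace : ∑ i ∈ I, (A (Sum.inl i) (Sum.inl i) + A (Sum.inr i) (Sum.inr i)) / 2 =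
      ∑ j, d j * w j := by
    rw [← Finset.sum_div, Finset.sum_add_distrib, ← Finset.sum_disjSum I I (fun b => A b b)]
    simp only [w, mul_div_assoc', ← Finset.sum_div, Finset.mul_sum]
    rw [Finset.sum_comm, hNA]
    simp only [transpose_mul_fromBlocks_diagonal_mul_apply_self]
  rw [htrace]
  refine sum_filter_lt_le_sum_mul hm (hd.nonneg hA) (fun j => by positivity) _ fun R => ?_
  have h := card_add_card_le_sum_sq hN R I
  rw [Finset.sum_disjSum, ← Finset.sum_add_distrib, Fintype.card_fin] at h
  simp only [w, ← Finset.sum_div, Finset.sum_add_distrib] at h ⊢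
  linarith

/-- `Δ_w(A)` is weakly supermajorized by the symplectic spectrum `d(A)`. -/
theorem stmt18 {n : ℕ} (A : Matrix (Fin n ⊕ Fin n) (Fin n ⊕ Fin n) ℝ)
    (hsymm : A.IsSymm) (hpd : A.PosDef)
    (d : Fin n → ℝ) (hd : IsSympSpectrum A d) (hm : Monotone d) :
    ∀ k : ℕ, 1 ≤ k → k ≤ n →
      ∑ j ∈ Finset.univ.filter (fun j : Fin n => (j : ℕ) < k), d j ≤
      psum (fun i => Real.sqrt
        (((A (Sum.inl i) (Sum.inl i)) ^ 2 + (A (Sum.inr i) (Sum.inr i)) ^ 2 +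
          2 * (A (Sum.inl i) (Sum.inr i)) ^ 2) / 2)) k := by
  intro k _ hk
  let x : Fin n → ℝ := fun i => Real.sqrt
    (((A (Sum.inl i) (Sum.inl i)) ^ 2 + (A (Sum.inr i) (Sum.inr i)) ^ 2 +
      2 * (A (Sum.inl i) (Sum.inr i)) ^ 2) / 2)
  let I := (Finset.univ.filter fun j : Fin n => (j : ℕ) < k).map (Tuple.sort x).toEmbedding
  have hI : I.card = k := by
    simp [I, Fin.card_filter_val_lt, hk]
  have h := sum_symplectic_eigenvalues_le hpd.posSemidef hd hm I
  rw [hI] at h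
  refine h.trans ((Finset.sum_le_sum fun i _ =>
    half_add_le_sqrt _ _ (A (Sum.inl i) (Sum.inr i))).trans_eq ?_)
  exact Finset.sum_map _ _ x
end

section
/- Let A be a 2n×2n real symmetric positive definite matrix and M = [u_1,...,u_n,v_1,...,v_n], M' = [x_1,...,x_n,y_1,...,y_n] be symplectic matrices, with M diagonalizing B ∈ Pd(2n) in the sense of Williamson. For any symplectic matrix N, the quantities s_{jk} = (1/2)((x_j^T N^T J u_k)^2 + (x_j^T N^T J v_k)^2 + (y_j^T N^T J u_k)^2 + (y_j^T N^T J v_k)^2) form a doubly superstochastic n×n matrix, and (1/2)(x_j^T N^T B N x_j + y_j^T N^T B N y_j) = Σ_{k=1}^n s_{jk} d_k(B). -/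
open Matrix BigOperators

/-- Perturbing a single entry of a vector changes its sum of squares as expected. -/
lemma sum_add_ite_sq {n : ℕ} (a : Fin n → ℝ) (i : Fin n) (t : ℝ) :
    ∑ k, (a k + if k = i then t else 0) ^ 2 = ∑ k, a k ^ 2 + 2 * t * a i + t ^ 2 := by
  have h : ∀ k, (a k + if k = i then t else 0) ^ 2 =
      a k ^ 2 + if k = i then 2 * t * a k + t ^ 2 else 0 := by
    intro k
    split_ifs <;> ring
  simp only [h, Finset.sum_add_distrib, Finset.sum_ite_eq', Finset.mem_univ, if_true]
  ring

/-- A nonnegative matrix all of whose submatrices satisfy the Hall type inequality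
`|R| + |C| ≤ n + ∑_{R × C} S` is doubly superstochastic. -/
lemma doublySuperstochastic_of_card_le {n : ℕ} (S : Matrix (Fin n) (Fin n) ℝ)
    (hS : ∀ i j, 0 ≤ S i j)
    (hall : ∀ R C : Finset (Fin n), (R.card : ℝ) + C.card ≤ n + ∑ i ∈ R, ∑ j ∈ C, S i j) :
    DoublySuperstochastic S := by
  let f : (Fin n → Fin n → ℝ) → ℝ := fun E =>
    ∑ i, (∑ j, E i j - 1) ^ 2 + ∑ j, (∑ i, E i j - 1) ^ 2
  have hf : Continuous f := by fun_prop
  obtain ⟨E, ⟨hE0, hES⟩, hmin⟩ :=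
    (isCompact_Icc (a := (0 : Fin n → Fin n → ℝ)) (b := fun i j => S i j)).exists_isMinOn
      ⟨0, le_refl _, hS⟩ hf.continuousOn
  replace hE0 : ∀ i j, 0 ≤ E i j := fun i j => hE0 i j
  replace hES : ∀ i j, E i j ≤ S i j := fun i j => hES i j
  set a : Fin n → ℝ := fun i => ∑ j, E i j - 1 with ha
  set b : Fin n → ℝ := fun j => ∑ i, E i j - 1 with hb
  have hvar : ∀ i j t, 0 ≤ E i j + t → E i j + t ≤ S i j → 0 ≤ t * (a i + b j + t) := by
    intro i j t h0 h1
    let E' : Fin n → Fin n → ℝ := fun k l => E k l + if k = i then if l = j then t else 0 else 0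
    have hmem : E' ∈ Set.Icc (0 : Fin n → Fin n → ℝ) (fun i j => S i j) := by
      constructor <;> intro k l <;> simp only [E', Pi.zero_apply] <;> split_ifs with hk hl
      · subst hk hl; exact h0
      · simpa using hE0 k l
      · simpa using hE0 k l
      · subst hk hl; exact h1
      · simpa using hES k l
      · simpa using hES k l
    have hle : f E ≤ f E' := hmin hmem
    have hrow : ∀ k, ∑ l, E' k l - 1 = a k + if k = i then t else 0 := by
      intro k
      by_cases hk : k = i
      · simp [E', ha, Finset.sum_add_distrib, hk]
        ring
      · simp [E', ha, hk]
    have hcol : ∀ l, ∑ k, E' k l - 1 = b l + if l = j then t else 0 := by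
      intro l
      simp only [E', hb, Finset.sum_add_distrib, Finset.sum_ite_eq', Finset.mem_univ, if_true]
      ring
    have hE' : f E' = f E + 2 * (t * (a i + b j + t)) := by
      simp only [f, hrow, hcol, sum_add_ite_sq, ha, hb]
      ring
    linarith
  have hneg : ∀ i j, a i + b j < 0 → E i j = S i j := by
    intro i j hij
    by_contra hne
    have hlt : E i j < S i j := lt_of_le_of_ne (hES i j) hne
    have ht : 0 < min (S i j - E i j) (-(a i + b j) / 2) :=
      lt_min (by linarith) (by linarith)
    have h1 := min_le_left (S i j - E i j) (-(a i + b j) / 2)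
    have h2 := min_le_right (S i j - E i j) (-(a i + b j) / 2)
    have h3 := hvar i j _ (by linarith [hE0 i j]) (by linarith)
    nlinarith
  have hpos : ∀ i j, 0 < a i + b j → E i j = 0 := by
    intro i j hij
    by_contra hne
    have hlt : 0 < E i j := lt_of_le_of_ne (hE0 i j) (Ne.symm hne)
    have ht : 0 < min (E i j) ((a i + b j) / 2) := lt_min hlt (by linarith)
    have h1 := min_le_left (E i j) ((a i + b j) / 2)
    have h2 := min_le_right (E i j) ((a i + b j) / 2)
    have h3 := hvar i j (-min (E i j) ((a i + b j) / 2)) (by linarith)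
      (by linarith [hES i j])
    nlinarith
  let R : Finset (Fin n) := Finset.univ.filter fun i => a i < 0
  let C : Finset (Fin n) := Finset.univ.filter fun j => b j ≤ 0
  have hRC : ∑ i ∈ R, ∑ j ∈ C, S i j = ∑ i ∈ R, ∑ j ∈ C, E i j := by
    refine Finset.sum_congr rfl fun i hi => Finset.sum_congr rfl fun j hj => ?_
    simp only [R, C, Finset.mem_filter, Finset.mem_univ, true_and] at hi hj
    exact (hneg i j (by linarith)).symm
  have hzero : ∑ i ∈ Rᶜ, ∑ j ∈ Cᶜ, E i j = 0 := by
    refine Finset.sum_eq_zero fun i hi => Finset.sum_eq_zero fun j hj => ?_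
    simp only [R, C, Finset.mem_compl, Finset.mem_filter, Finset.mem_univ, true_and,
      not_lt, not_le] at hi hj
    exact hpos i j (by linarith)
  have hrows : ∑ i ∈ R, ∑ j ∈ C, E i j + ∑ i ∈ R, ∑ j ∈ Cᶜ, E i j = ∑ i ∈ R, a i + R.card := by
    rw [← Finset.sum_add_distrib]
    simp [Finset.sum_add_sum_compl, ha]
  have hcols : ∑ i ∈ R, ∑ j ∈ Cᶜ, E i j + ∑ i ∈ Rᶜ, ∑ j ∈ Cᶜ, E i j =
      ∑ j ∈ Cᶜ, b j + (Cᶜ).card := by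
    rw [Finset.sum_add_sum_compl, Finset.sum_comm]
    simp [hb]
  have hcard : (C.card : ℝ) + (Cᶜ).card = n := by
    exact_mod_cast (Finset.card_add_card_compl C).trans (Fintype.card_fin n)
  have hkey : ∑ j ∈ Cᶜ, b j ≤ ∑ i ∈ R, a i := by linarith [hall R C]
  have ha0 : ∀ i, 0 ≤ a i := by
    intro i
    by_contra! hi
    have h1 : ∑ i ∈ R, a i < 0 :=
      Finset.sum_neg (fun k hk => (Finset.mem_filter.mp hk).2) ⟨i, by simp [R, hi]⟩
    have h2 : 0 ≤ ∑ j ∈ Cᶜ, b j := Finset.sum_nonneg fun j hj => by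
      simp only [C, Finset.mem_compl, Finset.mem_filter, Finset.mem_univ, true_and, not_le] at hj
      exact hj.le
    linarith
  have hb0 : ∀ j, b j ≤ 0 := by
    intro j
    by_contra! hj
    have h1 : ∑ i ∈ R, a i ≤ 0 :=
      Finset.sum_nonpos fun k hk => (Finset.mem_filter.mp hk).2.le
    have h2 : 0 < ∑ j ∈ Cᶜ, b j := Finset.sum_pos (fun k hk => by
      simpa [C] using hk) ⟨j, by simp [C, hj]⟩
    linarith
  have hab : ∑ i, a i = ∑ j, b j := by
    simp only [ha, hb, Finset.sum_sub_distrib]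
    rw [Finset.sum_comm]
  have hsa : ∑ i, a i = 0 := le_antisymm
    (hab ▸ Finset.sum_nonpos fun j _ => hb0 j) (Finset.sum_nonneg fun i _ => ha0 i)
  have hra := (Finset.sum_eq_zero_iff_of_nonneg fun i _ => ha0 i).mp hsa
  have hcb := (Finset.sum_eq_zero_iff_of_nonpos fun j _ => hb0 j).mp (hab ▸ hsa)
  exact ⟨E, ⟨hE0, fun i => sub_eq_zero.mp (hra i (Finset.mem_univ i)),
    fun j => sub_eq_zero.mp (hcb j (Finset.mem_univ j))⟩, hES⟩

/-- If `Y` does not shrink Euclidean norms, the `R × C` submatrix of `Y` has squared Frobenius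
norm at least `|R| + |C| - |κ|`. -/
lemma card_add_card_le_of_expanding {κ : Type*} [Fintype κ] [DecidableEq κ]
    (Y : Matrix κ κ ℝ) (hY : ∀ x : κ → ℝ, x ⬝ᵥ x ≤ (Y *ᵥ x) ⬝ᵥ (Y *ᵥ x)) (R C : Finset κ) :
    (R.card : ℝ) + C.card ≤ Fintype.card κ + ∑ i ∈ R, ∑ j ∈ C, Y i j ^ 2 := by
  let L : EuclideanSpace ℝ κ →ₗ[ℝ] ({i // i ∈ Rᶜ} → ℝ) × ({j // j ∈ Cᶜ} → ℝ) :=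
    { toFun := fun x => (fun i => (Y *ᵥ x.ofLp) i, fun j => x j)
      map_add' := fun x y => by
        ext <;> simp [Matrix.mulVec_add]
      map_smul' := fun c x => by
        ext <;> simp [Matrix.mulVec_smul] }
  let K := LinearMap.ker L
  have hdim : (R.card : ℝ) + C.card ≤ Fintype.card κ + Module.finrank ℝ K := by
    have h1 := L.finrank_range_add_finrank_ker
    have h2 := Submodule.finrank_le (LinearMap.range L)
    rw [finrank_euclideanSpace] at h1
    rw [Module.finrank_prod, Module.finrank_fintype_fun_eq_card,
      Module.finrank_fintype_fun_eq_card, Fintype.card_coe, Fintype.card_coe] at h2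
    have h3 := Finset.card_add_card_compl R
    have h4 := Finset.card_add_card_compl C
    have h5 : R.card + C.card ≤ Fintype.card κ + Module.finrank ℝ K := by
      change _ ≤ _ + Module.finrank ℝ (LinearMap.ker L)
      omega
    exact_mod_cast h5
  let e := stdOrthonormalBasis ℝ K
  have he : Orthonormal ℝ fun k => (e k : EuclideanSpace ℝ κ) :=
    e.orthonormal.comp_linearIsometry K.subtypeₗᵢ
  have heC : ∀ k, ∀ j ∉ C, (e k : EuclideanSpace ℝ κ) j = 0 := fun k j hj =>
    congrFun (congrArg Prod.snd (LinearMap.mem_ker.mp (e k).2)) ⟨j, by simpa using hj⟩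
  have heR : ∀ k, ∀ i ∉ R, (Y *ᵥ (e k : EuclideanSpace ℝ κ).ofLp) i = 0 := fun k i hi =>
    congrFun (congrArg Prod.fst (LinearMap.mem_ker.mp (e k).2)) ⟨i, by simpa using hi⟩
  have hbessel : ∀ i, ∑ k, (Y *ᵥ (e k : EuclideanSpace ℝ κ).ofLp) i ^ 2 ≤ ∑ j ∈ C, Y i j ^ 2 := by
    intro i
    let y : EuclideanSpace ℝ κ := WithLp.toLp 2 fun j => if j ∈ C then Y i j else 0
    have h := he.sum_inner_products_le y (s := Finset.univ)
    have hy : ‖y‖ ^ 2 = ∑ j ∈ C, Y i j ^ 2 := by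
      simp [EuclideanSpace.norm_sq_eq, y, ite_pow]
    have hin : ∀ k, inner ℝ (e k : EuclideanSpace ℝ κ) y =
        (Y *ᵥ (e k : EuclideanSpace ℝ κ).ofLp) i := by
      intro k
      rw [PiLp.inner_apply]
      refine Finset.sum_congr rfl fun j _ => ?_
      by_cases hj : j ∈ C
      · simp [y, hj]
      · simp [heC k j hj]
    rw [hy] at h
    simpa [hin] using h
  have hone : ∀ k, 1 ≤ ∑ i ∈ R, (Y *ᵥ (e k : EuclideanSpace ℝ κ).ofLp) i ^ 2 := by
    intro k
    have h1 : (e k : EuclideanSpace ℝ κ).ofLp ⬝ᵥ (e k : EuclideanSpace ℝ κ).ofLp = 1 := by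
      have h := EuclideanSpace.real_norm_sq_eq (e k : EuclideanSpace ℝ κ)
      rw [he.1 k] at h
      simp only [dotProduct, ← pow_two]
      linarith
    have h2 := hY (e k : EuclideanSpace ℝ κ).ofLp
    rw [h1] at h2
    refine h2.trans_eq ?_
    simp only [dotProduct, ← pow_two]
    exact (Finset.sum_subset (Finset.subset_univ R) fun i _ hi => by simp [heR k i hi]).symm
  have hK : (Module.finrank ℝ K : ℝ) ≤ ∑ i ∈ R, ∑ j ∈ C, Y i j ^ 2 :=
    calc (Module.finrank ℝ K : ℝ) = ∑ k : Fin (Module.finrank ℝ K), (1 : ℝ) := by simp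
      _ ≤ ∑ k, ∑ i ∈ R, (Y *ᵥ (e k : EuclideanSpace ℝ κ).ofLp) i ^ 2 :=
        Finset.sum_le_sum fun k _ => hone k
      _ = ∑ i ∈ R, ∑ k, (Y *ᵥ (e k : EuclideanSpace ℝ κ).ofLp) i ^ 2 := Finset.sum_comm
      _ ≤ _ := Finset.sum_le_sum fun i _ => hbessel i
  linarith

section Symplectic

variable {ι : Type*} [Fintype ι] [DecidableEq ι]

lemma Jm_transpose : (Jm ι)ᵀ = -Jm ι := by
  simp [Jm, Matrix.fromBlocks_transpose, Matrix.fromBlocks_neg]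

lemma Jm_mul_Jm : Jm ι * Jm ι = -1 := by
  simp [Jm, Matrix.fromBlocks_multiply, ← Matrix.fromBlocks_one, Matrix.fromBlocks_neg]

lemma IsSymplectic.mul {M N : Matrix (ι ⊕ ι) (ι ⊕ ι) ℝ} (hM : IsSymplectic M)
    (hN : IsSymplectic N) : IsSymplectic (M * N) := by
  unfold IsSymplectic at *
  calc (M * N)ᵀ * Jm ι * (M * N) = Nᵀ * (Mᵀ * Jm ι * M) * N := by
        simp only [Matrix.transpose_mul, Matrix.mul_assoc]
    _ = Jm ι := by rw [hM, hN]

lemma isSymplectic_Jm : IsSymplectic (Jm ι) := by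
  simp [IsSymplectic, Jm_transpose, Jm_mul_Jm]

lemma IsSymplectic.mul_inverse {M : Matrix (ι ⊕ ι) (ι ⊕ ι) ℝ} (hM : IsSymplectic M) :
    M * (-(Jm ι * Mᵀ * Jm ι)) = 1 := by
  rw [mul_eq_one_comm]
  unfold IsSymplectic at hM
  calc -(Jm ι * Mᵀ * Jm ι) * M = -(Jm ι * (Mᵀ * Jm ι * M)) := by
        simp only [Matrix.neg_mul, Matrix.mul_assoc]
    _ = 1 := by rw [hM, Jm_mul_Jm, neg_neg]

lemma IsSymplectic.transpose {M : Matrix (ι ⊕ ι) (ι ⊕ ι) ℝ} (hM : IsSymplectic M) :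
    IsSymplectic Mᵀ := by
  unfold IsSymplectic
  rw [Matrix.transpose_transpose]
  calc M * Jm ι * Mᵀ = M * (-(Jm ι * Mᵀ * Jm ι)) * Jm ι := by
        simp only [Matrix.mul_neg, Matrix.neg_mul, Matrix.mul_assoc, Jm_mul_Jm]
        simp
    _ = Jm ι := by rw [hM.mul_inverse, one_mul]

/-- The part of a symplectic matrix commuting with `J` does not shrink Euclidean norms. -/
lemma IsSymplectic.expanding {X : Matrix (ι ⊕ ι) (ι ⊕ ι) ℝ} (hX : IsSymplectic X)
    (x : ι ⊕ ι → ℝ) :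
    x ⬝ᵥ x ≤ (((1 / 2 : ℝ) • (X - Jm ι * X * Jm ι)) *ᵥ x) ⬝ᵥ
      (((1 / 2 : ℝ) • (X - Jm ι * X * Jm ι)) *ᵥ x) := by
  set W := Jm ι * X * Jm ι
  have hgram : ∀ P Q : Matrix (ι ⊕ ι) (ι ⊕ ι) ℝ,
      (P *ᵥ x) ⬝ᵥ (Q *ᵥ x) = x ⬝ᵥ ((Pᵀ * Q) *ᵥ x) := by
    intro P Q
    rw [← Matrix.mulVec_mulVec, Matrix.dotProduct_mulVec x, Matrix.vecMul_transpose]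
  have hXW : Xᵀ * W = -1 := by
    unfold IsSymplectic at hX
    calc Xᵀ * W = Xᵀ * Jm ι * X * Jm ι := by simp only [W, Matrix.mul_assoc]
      _ = -1 := by rw [hX, Jm_mul_Jm]
  have hcross : (X *ᵥ x) ⬝ᵥ (W *ᵥ x) = -(x ⬝ᵥ x) := by
    rw [hgram, hXW]
    simp [Matrix.neg_mulVec]
  have hsq : 0 ≤ (X *ᵥ x + W *ᵥ x) ⬝ᵥ (X *ᵥ x + W *ᵥ x) :=
    Finset.sum_nonneg fun i _ => mul_self_nonneg _
  simp only [Matrix.smul_mulVec, Matrix.sub_mulVec, smul_dotProduct, dotProduct_smul,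
    sub_dotProduct, dotProduct_sub, add_dotProduct, dotProduct_add, smul_eq_mul,
    dotProduct_comm (W *ᵥ x) (X *ᵥ x)] at hsq ⊢
  linarith

end Symplectic

/-- Half the sum of the Hadamard squares of the four blocks of a symplectic matrix is doubly
superstochastic. -/
lemma IsSymplectic.doublySuperstochastic {n : ℕ} {X : Matrix (Fin n ⊕ Fin n) (Fin n ⊕ Fin n) ℝ}
    (hX : IsSymplectic X) :
    DoublySuperstochastic (Matrix.of fun j k : Fin n => (1 / 2 : ℝ) *
      (X (.inl j) (.inl k) ^ 2 + X (.inl j) (.inr k) ^ 2 +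
        X (.inr j) (.inl k) ^ 2 + X (.inr j) (.inr k) ^ 2)) := by
  refine doublySuperstochastic_of_card_le _ (fun i j => ?_) fun R C => ?_
  · rw [Matrix.of_apply]
    positivity
  have h := card_add_card_le_of_expanding _ hX.expanding (R.disjSum R) (C.disjSum C)
  have hJ : Jm (Fin n) * X * Jm (Fin n) =
      Matrix.fromBlocks (-X.toBlocks₂₂) X.toBlocks₂₁ X.toBlocks₁₂ (-X.toBlocks₁₁) := by
    conv_lhs => rw [← Matrix.fromBlocks_toBlocks X]
    simp [Jm, Matrix.fromBlocks_multiply]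
  rw [hJ] at h
  simp only [Finset.card_disjSum, Finset.sum_disjSum, Fintype.card_sum, Fintype.card_fin,
    Nat.cast_add, Matrix.smul_apply, Matrix.sub_apply, Matrix.fromBlocks_apply₁₁,
    Matrix.fromBlocks_apply₁₂, Matrix.fromBlocks_apply₂₁, Matrix.fromBlocks_apply₂₂,
    Matrix.neg_apply, Matrix.toBlocks₁₁, Matrix.toBlocks₁₂, Matrix.toBlocks₂₁, Matrix.toBlocks₂₂,
    Matrix.of_apply, smul_eq_mul, ← Finset.sum_add_distrib] at h
  have hle := Finset.sum_le_sum fun i (_ : i ∈ R) => Finset.sum_le_sum fun j (_ : j ∈ C) =>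
    show ((1 / 2 * (X (.inl i) (.inl j) - -X (.inr i) (.inr j))) ^ 2 +
        (1 / 2 * (X (.inl i) (.inr j) - X (.inr i) (.inl j))) ^ 2 +
        ((1 / 2 * (X (.inr i) (.inl j) - X (.inl i) (.inr j))) ^ 2 +
        (1 / 2 * (X (.inr i) (.inr j) - -X (.inl i) (.inl j))) ^ 2)) ≤
      2 * ((1 / 2 : ℝ) * (X (.inl i) (.inl j) ^ 2 + X (.inl i) (.inr j) ^ 2 +
        X (.inr i) (.inl j) ^ 2 + X (.inr i) (.inr j) ^ 2)) by
      nlinarith [sq_nonneg (X (.inl i) (.inl j) - X (.inr i) (.inr j)),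
        sq_nonneg (X (.inl i) (.inr j) + X (.inr i) (.inl j))]
  simp only [← Finset.mul_sum] at hle h
  simp only [Matrix.of_apply, ← Finset.mul_sum]
  linarith

/-- A symplectic Williamson diagonalization `Mᵀ B M = D ⊕ D` recovers `B`. -/
lemma IsSymplectic.eq_of_diagonalizes {ι : Type*} [Fintype ι] [DecidableEq ι]
    {B M : Matrix (ι ⊕ ι) (ι ⊕ ι) ℝ} {d : ι → ℝ} (hM : IsSymplectic M)
    (hd : Mᵀ * B * M = Matrix.fromBlocks (Matrix.diagonal d) 0 0 (Matrix.diagonal d)) :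
    B = (Jm ι * M) * Matrix.diagonal (Sum.elim d d) * (Jm ι * M)ᵀ := by
  set K := -(Jm ι * Mᵀ * Jm ι) with hK
  have hMK : M * K = 1 := hM.mul_inverse
  have hKM : Kᵀ * Mᵀ = 1 := by rw [← Matrix.transpose_mul, hMK, Matrix.transpose_one]
  have hJD : Jm ι * (Mᵀ * B * M) * Jm ι = -Matrix.diagonal (Sum.elim d d) := by
    rw [hd]
    simp [Jm, Matrix.fromBlocks_multiply, ← Matrix.fromBlocks_diagonal, Matrix.fromBlocks_neg]
  calc B = (Kᵀ * Mᵀ) * B * (M * K) := by rw [hMK, hKM, one_mul, mul_one]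
    _ = -(Jm ι * M * (Jm ι * (Mᵀ * B * M) * Jm ι) * (Jm ι * M)ᵀ) := by
      simp only [hK, Matrix.transpose_neg, Matrix.transpose_mul, Jm_transpose,
        Matrix.transpose_transpose, Matrix.mul_neg, Matrix.neg_mul, Matrix.mul_assoc, neg_neg]
    _ = _ := by
      rw [hJD]
      simp only [Matrix.mul_neg, Matrix.neg_mul, neg_neg]

/-- The matrix `s_{jk}` built from a Williamson basis of `B`, a symplectic `M'` and any
symplectic `N` is doubly superstochastic, and
`(1/2)(xⱼᵀ Nᵀ B N xⱼ + yⱼᵀ Nᵀ B N yⱼ) = Σₖ s_{jk} d_k(B)`. -/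
theorem stmt19 {n : ℕ} (B M M' N : Matrix (Fin n ⊕ Fin n) (Fin n ⊕ Fin n) ℝ)
    (d : Fin n → ℝ)
    (hBsymm : B.IsSymm) (hBpd : B.PosDef)
    (hM : IsSymplectic M) (hM' : IsSymplectic M') (hN : IsSymplectic N)
    (hd : Mᵀ * B * M = Matrix.fromBlocks (Matrix.diagonal d) 0 0 (Matrix.diagonal d)) :
    DoublySuperstochastic (Matrix.of fun j k : Fin n =>
      (1 / 2 : ℝ) *
        (((fun r => M' r (Sum.inl j)) ⬝ᵥ Nᵀ.mulVec ((Jm (Fin n)).mulVec (fun r => M r (Sum.inl k)))) ^ 2 +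
         ((fun r => M' r (Sum.inl j)) ⬝ᵥ Nᵀ.mulVec ((Jm (Fin n)).mulVec (fun r => M r (Sum.inr k)))) ^ 2 +
         ((fun r => M' r (Sum.inr j)) ⬝ᵥ Nᵀ.mulVec ((Jm (Fin n)).mulVec (fun r => M r (Sum.inl k)))) ^ 2 +
         ((fun r => M' r (Sum.inr j)) ⬝ᵥ Nᵀ.mulVec ((Jm (Fin n)).mulVec (fun r => M r (Sum.inr k)))) ^ 2)) ∧
    ∀ j : Fin n,
      (1 / 2 : ℝ) *
        ((fun r => M' r (Sum.inl j)) ⬝ᵥ (Nᵀ * B * N).mulVec (fun r => M' r (Sum.inl j)) +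
         (fun r => M' r (Sum.inr j)) ⬝ᵥ (Nᵀ * B * N).mulVec (fun r => M' r (Sum.inr j))) =
      ∑ k : Fin n,
        ((1 / 2 : ℝ) *
          (((fun r => M' r (Sum.inl j)) ⬝ᵥ Nᵀ.mulVec ((Jm (Fin n)).mulVec (fun r => M r (Sum.inl k)))) ^ 2 +
           ((fun r => M' r (Sum.inl j)) ⬝ᵥ Nᵀ.mulVec ((Jm (Fin n)).mulVec (fun r => M r (Sum.inr k)))) ^ 2 +
           ((fun r => M' r (Sum.inr j)) ⬝ᵥ Nᵀ.mulVec ((Jm (Fin n)).mulVec (fun r => M r (Sum.inl k)))) ^ 2 +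
           ((fun r => M' r (Sum.inr j)) ⬝ᵥ Nᵀ.mulVec ((Jm (Fin n)).mulVec (fun r => M r (Sum.inr k)))) ^ 2)) *
        d k := by
  set X := M'ᵀ * Nᵀ * Jm (Fin n) * M with hX
  have hXsymp : IsSymplectic X :=
    ((hM'.transpose.mul hN.transpose).mul isSymplectic_Jm).mul hM
  have hentry : ∀ p q, (fun r => M' r p) ⬝ᵥ Nᵀ.mulVec ((Jm (Fin n)).mulVec (fun r => M r q)) =
      X p q := by
    intro p q
    rw [hX, Matrix.mul_assoc, Matrix.mul_assoc, Matrix.mul_apply_eq_vecMul]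
    rfl
  simp only [hentry]
  refine ⟨hXsymp.doublySuperstochastic, fun j => ?_⟩
  have hB : M'ᵀ * (Nᵀ * B * N) * M' = X * Matrix.diagonal (Sum.elim d d) * Xᵀ := by
    rw [hM.eq_of_diagonalizes hd, hX]
    simp only [Matrix.transpose_mul, Matrix.transpose_transpose, Matrix.mul_assoc]
  have hquad : ∀ p, (fun r => M' r p) ⬝ᵥ (Nᵀ * B * N).mulVec (fun r => M' r p) =
      ∑ k, (X p (.inl k) ^ 2 + X p (.inr k) ^ 2) * d k := by
    intro p
    have h : (fun r => M' r p) ⬝ᵥ (Nᵀ * B * N).mulVec (fun r => M' r p) =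
        (M'ᵀ * (Nᵀ * B * N) * M') p p := by
      rw [Matrix.mul_assoc M'ᵀ]
      rfl
    rw [h, hB, Matrix.mul_apply]
    simp only [Matrix.mul_diagonal, Matrix.transpose_apply, Fintype.sum_sum_type, Sum.elim_inl,
      Sum.elim_inr, ← Finset.sum_add_distrib]
    exact Finset.sum_congr rfl fun k _ => by ring
  rw [hquad, hquad, ← Finset.sum_add_distrib, Finset.mul_sum]
  exact Finset.sum_congr rfl fun k _ => by ring
end
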